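/- For each n let X_n be an n×n unitarily invariant random matrix with noncommutative entries, and assume that for every partitioned permutation (V,π) the limit K_{(V,π)} = lim_{n→∞} n^{|(V,π)|} κ_{(V,π)} exists and is finite. Then for all integers p₁,…,p_l ≥ 1 with k = p₁+⋯+p_l, the limit M_{p₁,…,p_l} = lim_{n→∞} n^{2(l−1)} k(tr X_n^{p₁},…,tr X_n^{p_l}) exists and equals Σ_{(V,π) ≤ (1_k,γ)} K_{(V,π)}, where γ ∈ S_k is the permutation with cycles (1,…,p₁)(p₁+1,…,p₁+p₂)⋯(p₁+⋯+p_{l−1}+1,…,k) and tr denotes the normalized trace. -/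

import Mathlib

open scoped Classical BigOperators
open Filter

noncomputable section

namespace HOF

instance setoidFinite {α : Type*} [Finite α] : Finite (Setoid α) :=
  Finite.of_injective (fun V : Setoid α => V.r)
    (fun V W h => Setoid.ext fun a b => by rw [show V.r = W.r from h])

instance setoidFintype {α : Type*} [Finite α] : Fintype (Setoid α) := Fintype.ofFinite _

instance matrixMeasurableSpace {n : ℕ} : MeasurableSpace (Matrix (Fin n) (Fin n) ℂ) :=
  MeasurableSpace.pi

variable {A : Type*}

/-- Ordered product of the `a i` over the indices in `S`, in increasing order of indices. -/
def ordProd [Monoid A] {l : ℕ} (a : Fin l → A) (S : Set (Fin l)) : A :=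
  (((List.finRange l).filter (fun i => decide (i ∈ S))).map a).prod

/-- The moment functional `E_V` associated to a set partition `V` (encoded as a `Setoid`):
the product over the blocks of `V` of `E` applied to the ordered product over each block. -/
def momentV {R : Type*} [CommRing R] [Monoid A] {l : ℕ} (E : A → R)
    (V : Setoid (Fin l)) (a : Fin l → A) : R :=
  ∏ᶠ B ∈ Setoid.classes V, E (ordProd a B)

/-- `k` is the family of tensor cumulants associated to the expectation `E`:
for every partition `V`, `∑_{W ≤ V} k_W = E_V`. -/
def IsCumulant {R : Type*} [CommRing R] [Monoid A] (E : A → R)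
    (k : ∀ {l : ℕ}, Setoid (Fin l) → (Fin l → A) → R) : Prop :=
  ∀ (l : ℕ) (V : Setoid (Fin l)) (a : Fin l → A),
    ∑ W ∈ Finset.univ.filter (fun W : Setoid (Fin l) => W ≤ V), k W a = momentV E V a

/-- Number of blocks of a partition. -/
def numBlocks {l : ℕ} (V : Setoid (Fin l)) : ℕ := (Setoid.classes V).ncard

/-- The partition of cycles of a permutation. -/
def cycleSetoid {l : ℕ} (π : Equiv.Perm (Fin l)) : Setoid (Fin l) :=
  ⟨π.SameCycle, ⟨fun x => Equiv.Perm.SameCycle.refl π x, fun h => h.symm, fun h h' => h.trans h'⟩⟩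

/-- Number of cycles of a permutation. -/
def numCycles {l : ℕ} (π : Equiv.Perm (Fin l)) : ℕ := numBlocks (cycleSetoid π)

/-- `π ≤ V` : every cycle of `π` is contained in a block of `V`, i.e. `(V, π)` is a
partitioned permutation. -/
def permLePartition {l : ℕ} (π : Equiv.Perm (Fin l)) (V : Setoid (Fin l)) : Prop :=
  ∀ i, V.r i (π i)

/-- Length `|π| = l - #π` of a permutation. -/
def permLen {l : ℕ} (π : Equiv.Perm (Fin l)) : ℤ := (l : ℤ) - numCycles π

/-- Length `|(V,π)| = |π| + 2(#π - #V)` of a partitioned permutation. -/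
def ppLen {l : ℕ} (V : Setoid (Fin l)) (π : Equiv.Perm (Fin l)) : ℤ :=
  ((l : ℤ) - numCycles π) + 2 * ((numCycles π : ℤ) - numBlocks V)

/-- The order `(V,π) ≤ (W,σ)` on partitioned permutations, i.e.
`(V,π) ⬝ (0, π⁻¹σ) = (W,σ)` (with lengths adding up). -/
def ppLe {l : ℕ} (V : Setoid (Fin l)) (π : Equiv.Perm (Fin l))
    (W : Setoid (Fin l)) (σ : Equiv.Perm (Fin l)) : Prop :=
  V ⊔ cycleSetoid (π⁻¹ * σ) = W ∧ ppLen V π + permLen (π⁻¹ * σ) = ppLen W σ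

/-- `(V,π)` and `(W,τ)` are conjugate by the permutation `σ`. -/
def ppConjBy {l : ℕ} (σ : Equiv.Perm (Fin l)) (V : Setoid (Fin l)) (π : Equiv.Perm (Fin l))
    (W : Setoid (Fin l)) (τ : Equiv.Perm (Fin l)) : Prop :=
  τ = σ * π * σ⁻¹ ∧ ∀ a b, W.r a b ↔ V.r (σ⁻¹ a) (σ⁻¹ b)

/-- `(V,π)` and `(W,τ)` are conjugate partitioned permutations. -/
def ppConj {l : ℕ} (V : Setoid (Fin l)) (π : Equiv.Perm (Fin l))
    (W : Setoid (Fin l)) (τ : Equiv.Perm (Fin l)) : Prop :=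
  ∃ σ : Equiv.Perm (Fin l), ppConjBy σ V π W τ

/-- The `(i,j)` entry of `U X U⁻¹ = U X U*` for a unitary `U` (with complex entries) and a
matrix `X` with noncommutative entries. -/
def conjEntry [Ring A] [Algebra ℂ A] {n : ℕ} (U : Matrix (Fin n) (Fin n) ℂ)
    (X : Matrix (Fin n) (Fin n) A) (i j : Fin n) : A :=
  ∑ a : Fin n, ∑ b : Fin n, (U i a * star (U j b)) • X a b

/-- A random matrix with noncommutative entries is unitarily invariant if for every unitary `U`
the joint distribution (all joint moments under `E`) of the entries of `U X U⁻¹` coincides with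
that of the entries of `X`. -/
def UnitarilyInvariant [Ring A] [Algebra ℂ A] (E : A → ℂ) {n : ℕ}
    (X : Matrix (Fin n) (Fin n) A) : Prop :=
  ∀ U ∈ Matrix.unitaryGroup (Fin n) ℂ, ∀ (m : ℕ) (i j : Fin m → Fin n),
    E (List.ofFn (fun t => conjEntry U X (i t) (j t))).prod
      = E (List.ofFn (fun t => X (i t) (j t))).prod

/-- `κ_{(V,π)} = k_V(X_{1π(1)}, …, X_{mπ(m)})`. -/
def kappa {n : ℕ} (k : ∀ {l : ℕ}, Setoid (Fin l) → (Fin l → A) → ℂ)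
    (X : Matrix (Fin n) (Fin n) A) {m : ℕ} (h : m ≤ n)
    (V : Setoid (Fin m)) (π : Equiv.Perm (Fin m)) : ℂ :=
  k V (fun t => X (Fin.castLE h t) (Fin.castLE h (π t)))

/-- The sequence `n ↦ κ_{(V,π)}(X_n)` (with junk value `0` for `n < m`). -/
def kappaSeq {A : ℕ → Type*} (k : ∀ n, ∀ {l : ℕ}, Setoid (Fin l) → (Fin l → A n) → ℂ)
    (X : ∀ n, Matrix (Fin n) (Fin n) (A n)) {m : ℕ}
    (V : Setoid (Fin m)) (π : Equiv.Perm (Fin m)) (n : ℕ) : ℂ :=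
  if h : m ≤ n then kappa (k n) (X n) h V π else 0

/-- Normalized trace of a matrix with entries in a `ℂ`-algebra. -/
def ncTrace [Ring A] [Algebra ℂ A] {n : ℕ} (X : Matrix (Fin n) (Fin n) A) : A :=
  ((n : ℂ)⁻¹) • Matrix.trace X

/-- Partial sums `p₁ + ⋯ + p_j`. -/
def psum {l : ℕ} (p : Fin l → ℕ) (j : ℕ) : ℕ := ∑ i : Fin l, if (i : ℕ) < j then p i else 0

/-- `γ` is the permutation with the cycles `(1,…,p₁)(p₁+1,…,p₁+p₂)⋯`. -/
def IsCycleType {l k : ℕ} (p : Fin l → ℕ) (γ : Equiv.Perm (Fin k)) : Prop :=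
  psum p l = k ∧
  (∀ (j : ℕ), j < l → ∀ t : Fin k, psum p j ≤ (t : ℕ) → (t : ℕ) + 1 < psum p (j + 1) →
    ((γ t : Fin k) : ℕ) = (t : ℕ) + 1) ∧
  (∀ (j : ℕ), j < l → ∀ t : Fin k, (t : ℕ) + 1 = psum p (j + 1) → ((γ t : Fin k) : ℕ) = psum p j)

/-- The section `Fin (m-1) → Fin m` merging `i` and `i+1` (both are hit by `i`). -/
def mergeEmb (m i : ℕ) (_hi : i + 1 < m) (t : Fin (m - 1)) : Fin m :=
  if (t : ℕ) ≤ i then ⟨t, by have := t.isLt; omega⟩ else ⟨(t : ℕ) + 1, by have := t.isLt; omega⟩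

/-- The partition of `{1,…,m-1}` obtained from a partition of `{1,…,m}` by merging the
elements `i` and `i+1` into a single element. -/
def mergeSetoid {m : ℕ} (W : Setoid (Fin m)) (i : ℕ) (hi : i + 1 < m) : Setoid (Fin (m - 1)) :=
  Setoid.comap (mergeEmb m i hi) W

/-- The tuple `(a₁, …, a_{i-1}, [a_i, a_{i+1}], a_{i+2}, …, a_m)` of length `m-1`. -/
def mergeSeq [Ring A] {m : ℕ} (a : Fin m → A) (i : ℕ) (hi : i + 1 < m)
    (t : Fin (m - 1)) : A :=
  if (t : ℕ) < i then a ⟨t, by have := t.isLt; omega⟩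
  else if (t : ℕ) = i then
    a ⟨i, by omega⟩ * a ⟨i + 1, hi⟩ - a ⟨i + 1, hi⟩ * a ⟨i, by omega⟩
  else a ⟨(t : ℕ) + 1, by have := t.isLt; omega⟩


section Partitions

variable {k : ℕ}

theorem numBlocks_eq_card (V : Setoid (Fin k)) : numBlocks V = Fintype.card (Quotient V) := by
  rw [numBlocks, ← Nat.card_coe_set_eq, ← Nat.card_eq_fintype_card]
  exact Nat.card_congr (Setoid.quotientEquivClasses V).symm

theorem numBlocks_strictAnti {V W : Setoid (Fin k)} (h : V < W) :
    numBlocks W < numBlocks V := by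
  rw [numBlocks_eq_card, numBlocks_eq_card]
  have hle : ∀ a b, V a b → W a b := fun a b hab => h.le hab
  have hs : Function.Surjective (Quotient.map' id hle : Quotient V → Quotient W) := by
    rintro ⟨x⟩
    exact ⟨Quotient.mk V x, rfl⟩
  refine Fintype.card_lt_of_surjective_not_injective _ hs fun hi => h.not_ge fun a b hab => ?_
  exact Quotient.exact (hi (a₁ := Quotient.mk V a) (a₂ := Quotient.mk V b)
    (Quotient.sound (s := W) hab))

theorem numBlocks_anti {V W : Setoid (Fin k)} (h : V ≤ W) : numBlocks W ≤ numBlocks V := by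
  rcases h.eq_or_lt with rfl | h
  · exact le_rfl
  · exact (numBlocks_strictAnti h).le

theorem numBlocks_ker {β : Type*} [Fintype β] {f : Fin k → β} (hf : Function.Surjective f) :
    numBlocks (Setoid.ker f) = Fintype.card β := by
  rw [numBlocks_eq_card]
  exact Fintype.card_congr (Setoid.quotientKerEquivOfSurjective f hf)

theorem numBlocks_top (hk : 0 < k) : numBlocks (⊤ : Setoid (Fin k)) = 1 := by
  rw [numBlocks_eq_card, Fintype.card_eq_one_iff]
  refine ⟨Quotient.mk _ ⟨0, hk⟩, ?_⟩
  rintro ⟨x⟩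
  exact Quotient.sound (s := (⊤ : Setoid (Fin k))) trivial

/-- Adjoining one pair to a partition lowers the number of blocks by at most one. -/
theorem numBlocks_le_succ {V W : Setoid (Fin k)} (a b : Fin k)
    (hW : ∀ T : Setoid (Fin k), V ≤ T → T a b → W ≤ T) : numBlocks V ≤ numBlocks W + 1 := by
  let f : Quotient V → Quotient V := fun q => if q = Quotient.mk V a then Quotient.mk V b else q
  let g : Fin k → Set.range f := fun x => ⟨f (Quotient.mk V x), _, rfl⟩
  have hg : Function.Surjective g := by
    rintro ⟨_, ⟨x⟩, rfl⟩
    exact ⟨x, rfl⟩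
  have h1 : W ≤ Setoid.ker g := by
    refine hW _ (fun x y hxy => ?_) ?_
    · have : Quotient.mk V x = Quotient.mk V y := Quotient.sound hxy
      simp [Setoid.ker_def, g, this]
    · simp [Setoid.ker_def, g, f]
  have h2 := numBlocks_anti h1
  rw [numBlocks_ker hg] at h2
  have h3 : Fintype.card (Quotient V) ≤ Fintype.card (Option (Set.range f)) := by
    refine Fintype.card_le_of_injective (fun q => if h : q = Quotient.mk V a then none
      else some ⟨f q, q, rfl⟩) fun q q' hqq => ?_
    by_cases h : q = Quotient.mk V a <;> by_cases h' : q' = Quotient.mk V a <;>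
      simp_all [f]
  rw [Fintype.card_option] at h3
  rw [numBlocks_eq_card]
  omega

theorem cycleSetoid_le_iff {π : Equiv.Perm (Fin k)} {V : Setoid (Fin k)} :
    cycleSetoid π ≤ V ↔ permLePartition π V := by
  constructor
  · intro h i
    exact h (show π.SameCycle i (π i) from ⟨1, by simp⟩)
  · rintro h a b ⟨m, rfl⟩
    have hi : ∀ x, V x (π⁻¹ x) := fun x => by
      have := h (π⁻¹ x)
      exact V.symm (by simpa using this)
    induction m using Int.induction_on with
    | zero => exact V.refl _
    | succ m ih =>
      rw [add_comm, zpow_add, zpow_one, Equiv.Perm.mul_apply]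
      exact V.trans ih (h _)
    | pred m ih =>
      rw [sub_eq_add_neg, add_comm, zpow_add, zpow_neg_one, Equiv.Perm.mul_apply]
      exact V.trans ih (hi _)

theorem permLePartition_cycleSetoid (π : Equiv.Perm (Fin k)) :
    permLePartition π (cycleSetoid π) :=
  cycleSetoid_le_iff.1 le_rfl

theorem permLePartition.mono {π : Equiv.Perm (Fin k)} {V W : Setoid (Fin k)}
    (h : permLePartition π V) (hVW : V ≤ W) : permLePartition π W :=
  fun i => hVW (h i)

theorem permLePartition.mul {π σ : Equiv.Perm (Fin k)} {V : Setoid (Fin k)}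
    (hπ : permLePartition π V) (hσ : permLePartition σ V) : permLePartition (π * σ) V :=
  fun i => V.trans (hσ i) (hπ (σ i))

theorem permLePartition.inv {π : Equiv.Perm (Fin k)} {V : Setoid (Fin k)}
    (hπ : permLePartition π V) : permLePartition π⁻¹ V := fun i => by
  have := hπ (π⁻¹ i)
  exact V.symm (by simpa using this)

theorem permLePartition_swap {a b : Fin k} {V : Setoid (Fin k)} (h : V a b) :
    permLePartition (Equiv.swap a b) V := fun i => by
  rcases eq_or_ne i a with rfl | ha
  · rwa [Equiv.swap_apply_left]
  · rcases eq_or_ne i b with rfl | hb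
    · rw [Equiv.swap_apply_right]
      exact V.symm h
    · rw [Equiv.swap_apply_of_ne_of_ne ha hb]

/-- Multiplying by a transposition of two elements in different cycles joins these cycles. -/
theorem sameCycle_mul_swap {π : Equiv.Perm (Fin k)} {a b : Fin k} (h : ¬ π.SameCycle a b) :
    (π * Equiv.swap a b).SameCycle a b := by
  have hp : 0 < Function.minimalPeriod π a :=
    Function.minimalPeriod_pos_of_mem_periodicPts (π.injective.mem_periodicPts a)
  have key : ∀ j < Function.minimalPeriod π a,
      ((π * Equiv.swap a b) ^ (j + 1)) b = (π ^ (j + 1)) a := by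
    intro j
    induction j with
    | zero => simp
    | succ j ih =>
      intro hj
      rw [pow_succ', Equiv.Perm.mul_apply, ih (by omega), pow_succ' π (j + 1),
        Equiv.Perm.mul_apply, Equiv.Perm.mul_apply, Equiv.swap_apply_of_ne_of_ne]
      · intro h0
        refine Function.not_isPeriodicPt_of_pos_of_lt_minimalPeriod (Nat.succ_ne_zero j) hj ?_
        rw [Function.IsPeriodicPt, Function.IsFixedPt, ← Equiv.Perm.coe_pow]
        exact h0
      · intro h0
        exact h ⟨(j + 1 : ℕ), by rw [zpow_natCast]; exact h0⟩
  refine Equiv.Perm.SameCycle.symm ⟨(Function.minimalPeriod π a : ℕ), ?_⟩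
  have h1 := key (Function.minimalPeriod π a - 1) (by omega)
  rw [Nat.sub_add_cancel hp] at h1
  rw [zpow_natCast, h1]
  have := Function.isPeriodicPt_minimalPeriod π a
  rwa [Function.IsPeriodicPt, Function.IsFixedPt, ← Equiv.Perm.coe_pow] at this

theorem numCycles_mul_swap_le (π : Equiv.Perm (Fin k)) (a b : Fin k) :
    numCycles (π * Equiv.swap a b) ≤ numCycles π + 1 := by
  refine numBlocks_le_succ a b fun T hT hab => ?_
  rw [cycleSetoid_le_iff] at hT ⊢
  have := hT.mul (permLePartition_swap hab)
  rwa [mul_assoc, Equiv.swap_mul_self, mul_one] at this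

theorem numCycles_mul_swap_lt {π : Equiv.Perm (Fin k)} {a b : Fin k}
    (h : ¬ π.SameCycle a b) : numCycles (π * Equiv.swap a b) < numCycles π := by
  refine numBlocks_strictAnti (lt_of_le_not_ge ?_ fun hle => h (hle (sameCycle_mul_swap h)))
  rw [cycleSetoid_le_iff]
  have := (permLePartition_cycleSetoid (π * Equiv.swap a b)).mul
    (permLePartition_swap (sameCycle_mul_swap h))
  rwa [mul_assoc, Equiv.swap_mul_self, mul_one] at this

/-- The triangle inequality for the length of partitioned permutations. -/
theorem numCycles_mul_add_le (σ : Equiv.Perm (Fin k)) : ∀ {V : Setoid (Fin k)}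
    {π : Equiv.Perm (Fin k)}, permLePartition π V →
    numCycles (π * σ) + numCycles σ + 2 * numBlocks V ≤
      k + numCycles π + 2 * numBlocks (V ⊔ cycleSetoid σ) := by
  induction hs : σ.support.card using Nat.strong_induction_on generalizing σ with
  | _ m ih =>
  intro V π hπ
  by_cases hσ : σ = 1
  · subst hσ
    have h1 : cycleSetoid (1 : Equiv.Perm (Fin k)) = ⊥ := by
      rw [eq_bot_iff, cycleSetoid_le_iff]
      exact fun i => rfl
    have h2 : numCycles (1 : Equiv.Perm (Fin k)) ≤ k := by
      rw [numCycles, numBlocks_eq_card]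
      exact (Fintype.card_le_of_surjective (Quotient.mk _) Quotient.mk_surjective).trans_eq
        (Fintype.card_fin k)
    rw [mul_one, h1, sup_bot_eq]
    omega
  obtain ⟨a, ha⟩ : ∃ a, σ a ≠ a := by
    by_contra! h
    exact hσ (Equiv.ext h)
  set τ := Equiv.swap a (σ a) with hτ
  have hcard : (τ * σ).support.card < m := by
    rw [← hs]
    exact Equiv.Perm.card_support_swap_mul ha
  have hσa : cycleSetoid σ a (σ a) := permLePartition_cycleSetoid σ a
  have hσeq : τ * (τ * σ) = σ := by rw [← mul_assoc, Equiv.swap_mul_self, one_mul]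
  have hfix : (τ * σ) a = a := by simp [hτ]
  have hlt : numCycles σ < numCycles (τ * σ) := by
    refine numBlocks_strictAnti (lt_of_le_not_ge ?_ fun hle => ?_)
    · rw [cycleSetoid_le_iff]
      exact (permLePartition_swap hσa).mul (permLePartition_cycleSetoid σ)
    · have h1 : (τ * σ).SameCycle a (σ a) := hle hσa
      exact ha (h1.eq_of_left hfix).symm
  have hsup : (V ⊔ cycleSetoid τ) ⊔ cycleSetoid (τ * σ) ≤ V ⊔ cycleSetoid σ := by
    refine sup_le (sup_le le_sup_left (le_trans ?_ le_sup_right)) (le_trans ?_ le_sup_right)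
    · rw [cycleSetoid_le_iff]
      exact permLePartition_swap hσa
    · rw [cycleSetoid_le_iff]
      exact (permLePartition_swap hσa).mul (permLePartition_cycleSetoid σ)
  have hge := numBlocks_anti (V := V ⊔ cycleSetoid σ)
    (W := (V ⊔ cycleSetoid τ) ⊔ cycleSetoid (τ * σ)) (by
      refine sup_le (le_sup_left.trans le_sup_left) ?_
      rw [cycleSetoid_le_iff, ← hσeq]
      refine permLePartition.mul ?_ ?_
      · exact (permLePartition_cycleSetoid τ).mono (le_sup_right.trans le_sup_left)
      · rw [hσeq]
        exact (permLePartition_cycleSetoid _).mono le_sup_right)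
  have hπτ : permLePartition (π * τ) (V ⊔ cycleSetoid τ) :=
    (hπ.mono le_sup_left).mul ((permLePartition_cycleSetoid τ).mono le_sup_right)
  have key := ih _ hcard (τ * σ) rfl hπτ
  rw [mul_assoc, hσeq] at key
  have hstep : numCycles (π * τ) + 2 * numBlocks V ≤
      numCycles π + 1 + 2 * numBlocks (V ⊔ cycleSetoid τ) := by
    by_cases hV : V a (σ a)
    · have h1 : V ⊔ cycleSetoid τ = V :=
        sup_eq_left.2 (cycleSetoid_le_iff.2 (permLePartition_swap hV))
      rw [h1]
      have := numCycles_mul_swap_le π a (σ a)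
      rw [← hτ] at this
      omega
    · have h1 : ¬ π.SameCycle a (σ a) := fun h => hV (cycleSetoid_le_iff.2 hπ h)
      have h2 := numCycles_mul_swap_lt h1
      rw [← hτ] at h2
      have h3 : numBlocks V ≤ numBlocks (V ⊔ cycleSetoid τ) + 1 :=
        numBlocks_le_succ a (σ a) fun T hT hab =>
          sup_le hT (cycleSetoid_le_iff.2 (permLePartition_swap hab))
      omega
  omega

end Partitions

section Cumulants

variable {m : ℕ}

/-- Uniqueness of Möbius inversion on the lattice of partitions. -/
theorem eq_of_sum_le_eq {R : Type*} [AddCommGroup R] {f g : Setoid (Fin m) → R}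
    (V : Setoid (Fin m))
    (h : ∀ U ≤ V, ∑ W ∈ Finset.univ.filter (fun W : Setoid (Fin m) => W ≤ U), f W =
      ∑ W ∈ Finset.univ.filter (fun W : Setoid (Fin m) => W ≤ U), g W) : f V = g V := by
  induction V using WellFoundedLT.induction with
  | _ V ih =>
  have hins : Finset.univ.filter (fun W : Setoid (Fin m) => W ≤ V) =
      insert V (Finset.univ.filter (fun W : Setoid (Fin m) => W < V)) := by
    ext W
    simp [le_iff_eq_or_lt]
  have hV := h V le_rfl
  rw [hins, Finset.sum_insert (by simp), Finset.sum_insert (by simp),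
    Finset.sum_congr rfl fun W hW => ih W (Finset.mem_filter.1 hW).2 fun U hU =>
      h U (hU.trans (Finset.mem_filter.1 hW).2.le)] at hV
  exact add_right_cancel hV

theorem momentV_eq_prod {R : Type*} [CommRing R] [Monoid A] (E : A → R) (V : Setoid (Fin m))
    (a : Fin m → A) :
    momentV E V a = ∏ B ∈ (Set.toFinite (Setoid.classes V)).toFinset, E (ordProd a B) :=
  finprod_mem_eq_finite_toFinset_prod _ _

theorem ordProd_congr [Monoid A] {a b : Fin m → A} {S : Set (Fin m)}
    (h : ∀ t ∈ S, a t = b t) : ordProd a S = ordProd b S := by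
  refine congrArg List.prod (List.map_congr_left fun t ht => h t ?_)
  simpa using (List.mem_filter.1 ht).2

theorem exists_ordProd_update [Monoid A] (a : Fin m → A) {S : Set (Fin m)} {t : Fin m}
    (ht : t ∈ S) : ∃ P Q : A, ∀ x, ordProd (Function.update a t x) S = P * x * Q := by
  have hmem : t ∈ (List.finRange m).filter (fun i => decide (i ∈ S)) := by
    simp [ht]
  obtain ⟨L₁, L₂, hL⟩ := List.append_of_mem hmem
  have hnd : ((List.finRange m).filter (fun i => decide (i ∈ S))).Nodup :=
    (List.nodup_finRange m).filter _
  rw [hL, List.nodup_append] at hnd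
  obtain ⟨-, h2, h3⟩ := hnd
  refine ⟨(L₁.map a).prod, (L₂.map a).prod, fun x => ?_⟩
  have e1 : L₁.map (Function.update a t x) = L₁.map a :=
    List.map_congr_left fun s hs => Function.update_of_ne (h3 s hs t (by simp)) _ _
  have e2 : L₂.map (Function.update a t x) = L₂.map a :=
    List.map_congr_left fun s hs => Function.update_of_ne (fun h => by
      rw [h] at hs
      exact (List.nodup_cons.1 h2).1 hs) _ _
  rw [ordProd, hL, List.map_append, List.map_cons, e1, e2, Function.update_self,
    List.prod_append, List.prod_cons, mul_assoc]

variable [Ring A] [Algebra ℂ A] (E : A →ₗ[ℂ] ℂ)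
  (k : ∀ {l : ℕ}, Setoid (Fin l) → (Fin l → A) → ℂ)

theorem exists_momentV_update (V : Setoid (Fin m)) (a : Fin m → A) (t : Fin m) :
    ∃ L : A →ₗ[ℂ] ℂ, ∀ x, momentV E V (Function.update a t x) = L x := by
  obtain ⟨P, Q, hPQ⟩ := exists_ordProd_update a (S := {s | V s t}) (V.refl t)
  have hB : {s | V s t} ∈ (Set.toFinite (Setoid.classes V)).toFinset := by
    rw [Set.Finite.mem_toFinset]
    exact V.mem_classes t
  refine ⟨(∏ B ∈ (Set.toFinite (Setoid.classes V)).toFinset.erase {s | V s t},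
    E (ordProd a B)) • E ∘ₗ LinearMap.mulRight ℂ Q ∘ₗ LinearMap.mulLeft ℂ P, fun x => ?_⟩
  rw [momentV_eq_prod, ← Finset.prod_erase_mul _ _ hB, hPQ]
  refine congrArg₂ _ (Finset.prod_congr rfl fun B hB' => ?_) (by simp)
  rw [Finset.mem_erase, Set.Finite.mem_toFinset] at hB'
  refine congrArg E (ordProd_congr fun s hs => Function.update_of_ne (fun hst => hB'.1 ?_) _ _)
  subst hst
  exact Setoid.eq_of_mem_classes hB'.2 hs (V.mem_classes s) (V.refl s)

variable {k}

theorem cumulant_congr (hk : IsCumulant (⇑E) @k) {V : Setoid (Fin m)} {a b : Fin m → A}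
    (h : ∀ W ≤ V, momentV E W a = momentV E W b) : k V a = k V b :=
  eq_of_sum_le_eq (f := fun W => k W a) (g := fun W => k W b) V fun U hU => by
    rw [hk m U a, hk m U b, h U hU]

/-- The cumulants as multilinear maps. -/
def cumulantMultilinear (hk : IsCumulant (⇑E) @k) (V : Setoid (Fin m)) :
    MultilinearMap ℂ (fun _ : Fin m => A) ℂ where
  toFun := k V
  map_update_add' := by
    intro inst a t x y
    obtain rfl : inst = instDecidableEqFin m := Subsingleton.elim _ _
    refine eq_of_sum_le_eq (f := fun W => k W (Function.update a t (x + y)))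
      (g := fun W => k W (Function.update a t x) + k W (Function.update a t y)) V fun U _ => ?_
    obtain ⟨L, hL⟩ := exists_momentV_update E U a t
    rw [Finset.sum_add_distrib, hk m U, hk m U, hk m U, hL, hL, hL, map_add]
  map_update_smul' := by
    intro inst a t c x
    obtain rfl : inst = instDecidableEqFin m := Subsingleton.elim _ _
    refine eq_of_sum_le_eq (f := fun W => k W (Function.update a t (c • x)))
      (g := fun W => c • k W (Function.update a t x)) V fun U _ => ?_
    obtain ⟨L, hL⟩ := exists_momentV_update E U a t
    rw [← Finset.smul_sum, hk m U, hk m U, hL, hL, map_smul]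

theorem ordProd_conjEntry {n : ℕ} {X : Matrix (Fin n) (Fin n) A}
    (hX : UnitarilyInvariant (⇑E) X) {U : Fin m → Matrix (Fin n) (Fin n) ℂ}
    (hU : ∀ t, U t ∈ Matrix.unitaryGroup (Fin n) ℂ) (i j : Fin m → Fin n) (S : Set (Fin m))
    (hS : ∀ s ∈ S, ∀ t ∈ S, U s = U t) :
    E (ordProd (fun t => conjEntry (U t) X (i t) (j t)) S) =
      E (ordProd (fun t => X (i t) (j t)) S) := by
  obtain ⟨U₀, hU₀, h₀⟩ : ∃ U₀ ∈ Matrix.unitaryGroup (Fin n) ℂ, ∀ t ∈ S, U t = U₀ := by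
    rcases S.eq_empty_or_nonempty with rfl | ⟨s, hs⟩
    · exact ⟨1, one_mem _, by simp⟩
    · exact ⟨U s, hU s, fun t ht => hS t ht s hs⟩
  have hlist : ∀ (L : List (Fin m)) (f : Fin m → A),
      L.map f = List.ofFn (fun r => f (L.get r)) := by
    intro L f
    conv_lhs => rw [← List.ofFn_get L, List.map_ofFn]
    rfl
  rw [ordProd_congr (b := fun t => conjEntry U₀ X (i t) (j t)) fun t ht => by
    rw [h₀ t ht], ordProd, ordProd, hlist, hlist]
  exact hX U₀ hU₀ _ (fun r => i (List.get _ r)) (fun r => j (List.get _ r))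

/-- Cumulants of entries of a unitarily invariant matrix do not change when the entries are
conjugated by unitaries that are constant on the blocks of the partition. -/
theorem cumulant_conjEntry (hk : IsCumulant (⇑E) @k) {n : ℕ} {X : Matrix (Fin n) (Fin n) A}
    (hX : UnitarilyInvariant (⇑E) X) {V : Setoid (Fin m)}
    {U : Fin m → Matrix (Fin n) (Fin n) ℂ} (hU : ∀ t, U t ∈ Matrix.unitaryGroup (Fin n) ℂ)
    (hUV : ∀ s t, V s t → U s = U t) (i j : Fin m → Fin n) :
    k V (fun t => conjEntry (U t) X (i t) (j t)) = k V (fun t => X (i t) (j t)) := by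
  refine cumulant_congr E hk fun W hW => ?_
  rw [momentV_eq_prod, momentV_eq_prod]
  refine Finset.prod_congr rfl fun B hB => ?_
  rw [Set.Finite.mem_toFinset] at hB
  obtain ⟨y, rfl⟩ := hB
  exact ordProd_conjEntry E hX hU i j _ fun s hs t ht =>
    hUV s t (hW (W.trans hs (W.symm ht)))

theorem cumulant_eq_sum (hk : IsCumulant (⇑E) @k) {n : ℕ} {X : Matrix (Fin n) (Fin n) A}
    (hX : UnitarilyInvariant (⇑E) X) {V : Setoid (Fin m)}
    {U : Fin m → Matrix (Fin n) (Fin n) ℂ} (hU : ∀ t, U t ∈ Matrix.unitaryGroup (Fin n) ℂ)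
    (hUV : ∀ s t, V s t → U s = U t) (i j : Fin m → Fin n) :
    k V (fun t => X (i t) (j t)) = ∑ a : Fin m → Fin n × Fin n,
      (∏ t, (U t (i t) (a t).1 * star (U t (j t) (a t).2))) *
        k V (fun t => X (a t).1 (a t).2) := by
  rw [← cumulant_conjEntry E hk hX hU hUV]
  have h1 : (fun t => conjEntry (U t) X (i t) (j t)) = fun t => ∑ a : Fin n × Fin n,
      (U t (i t) a.1 * star (U t (j t) a.2)) • X a.1 a.2 := by
    funext t
    rw [Fintype.sum_prod_type]
    rfl
  rw [h1]
  change cumulantMultilinear E hk V _ = _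
  rw [MultilinearMap.map_sum]
  refine Finset.sum_congr rfl fun a _ => ?_
  rw [MultilinearMap.map_smul_univ]
  rfl

end Cumulants

section InvariantTensors

variable {m n : ℕ}

/-- Invariance of a tensor under conjugation by families of unitaries which are constant on the
blocks of `V`. -/
def BlockInvariant (V : Setoid (Fin m)) (T : (Fin m → Fin n × Fin n) → ℂ) : Prop :=
  ∀ U : Fin m → Matrix (Fin n) (Fin n) ℂ, (∀ t, U t ∈ Matrix.unitaryGroup (Fin n) ℂ) →
    (∀ s t, V s t → U s = U t) → ∀ c, T c = ∑ a : Fin m → Fin n × Fin n,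
      (∏ t, (U t (c t).1 (a t).1 * star (U t (c t).2 (a t).2))) * T a

theorem sum_prod_deriv {P : Type*} [Fintype P] {T : (Fin m → P) → ℂ} {c : Fin m → P}
    {G : ℝ → P → P → ℂ} {M : P → P → ℂ} (h0 : ∀ p q, G 0 p q = if q = p then 1 else 0)
    (hG : ∀ p q, HasDerivAt (fun θ => G θ p q) (M p q) 0)
    (hT : ∀ θ, T c = ∑ a : Fin m → P, (∏ t, G θ (c t) (a t)) * T a) :
    ∑ t, ∑ q, M (c t) q * T (Function.update c t q) = 0 := by
  have h1 : HasDerivAt (fun θ : ℝ => ∑ a : Fin m → P, (∏ t, G θ (c t) (a t)) * T a)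
      (∑ a : Fin m → P, (∑ t, (∏ s ∈ Finset.univ.erase t, G 0 (c s) (a s)) •
        M (c t) (a t)) * T a) 0 :=
    HasDerivAt.fun_sum fun a _ => HasDerivAt.mul_const
      (HasDerivAt.fun_finsetProd fun t _ => hG (c t) (a t)) _
  have h2 : HasDerivAt (fun θ : ℝ => ∑ a : Fin m → P, (∏ t, G θ (c t) (a t)) * T a) 0 0 := by
    simp_rw [← hT]
    exact hasDerivAt_const _ _
  refine Eq.trans ?_ (h1.unique h2)
  simp_rw [Finset.sum_mul]
  rw [Finset.sum_comm (s := (Finset.univ : Finset (Fin m → P)))]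
  refine Finset.sum_congr rfl fun t _ => ?_
  refine Fintype.sum_of_injective (fun q => Function.update c t q)
    (Function.update_injective c t) _ _ (fun a ha => ?_) fun q => ?_
  · obtain ⟨s, hs, hsa⟩ : ∃ s, s ≠ t ∧ a s ≠ c s := by
      by_contra! h
      exact ha ⟨a t, by
        funext s
        rcases eq_or_ne s t with rfl | hs
        · simp
        · exact (Function.update_of_ne hs _ _).trans (h s hs).symm⟩
    rw [Finset.prod_eq_zero (i := s) (by simp [hs]) (by rw [h0, if_neg hsa]), zero_smul, zero_mul]
  · rw [Finset.prod_eq_one, one_smul, Function.update_self]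
    intro s hs
    rw [Function.update_of_ne (Finset.ne_of_mem_erase hs), h0, if_pos rfl]

/-- The infinitesimal generator of rotations in the plane of the coordinates `x` and `y`. -/
def rotGen (x y : Fin n) (z : ℂ) : Matrix (Fin n) (Fin n) ℂ :=
  Matrix.single x y z - Matrix.single y x (star z)

/-- Rotations in the plane of the coordinates `x` and `y`. -/
def rot (x y : Fin n) (z : ℂ) (θ : ℝ) : Matrix (Fin n) (Fin n) ℂ :=
  1 + ((Real.cos θ - 1 : ℝ) : ℂ) • (Matrix.single x x 1 + Matrix.single y y 1) +
    ((Real.sin θ : ℝ) : ℂ) • rotGen x y z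

theorem rot_mem_unitaryGroup {x y : Fin n} (hxy : x ≠ y) {z : ℂ} (hz : z * star z = 1) (θ : ℝ) :
    rot x y z θ ∈ Matrix.unitaryGroup (Fin n) ℂ := by
  have hz' : star z * z = 1 := by rw [mul_comm, hz]
  rw [Matrix.mem_unitaryGroup_iff]
  set P : Matrix (Fin n) (Fin n) ℂ := Matrix.single x x 1 + Matrix.single y y 1 with hP
  have hPP : P * P = P := by
    simp [hP, add_mul, mul_add, hxy, hxy.symm]
  have hPN : P * rotGen x y z = rotGen x y z := by
    simp [hP, rotGen, add_mul, mul_sub, hxy, hxy.symm]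
  have hNP : rotGen x y z * P = rotGen x y z := by
    simp [hP, rotGen, sub_mul, mul_add, hxy, hxy.symm]
    abel
  have hNN : rotGen x y z * rotGen x y z = -P := by
    simp only [hP, rotGen, sub_mul, mul_sub, Matrix.single_mul_single_same,
      Matrix.single_mul_single_of_ne _ _ _ _ hxy, Matrix.single_mul_single_of_ne _ _ _ _ hxy.symm,
      hz, hz']
    abel
  have hPs : star P = P := by
    simp [hP, Matrix.star_eq_conjTranspose, Matrix.conjTranspose_single]
  have hNs : star (rotGen x y z) = -rotGen x y z := by
    simp [rotGen, Matrix.star_eq_conjTranspose, Matrix.conjTranspose_single]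
  have hcs : ((Real.cos θ : ℝ) : ℂ) ^ 2 + ((Real.sin θ : ℝ) : ℂ) ^ 2 = 1 := by
    exact_mod_cast Real.cos_sq_add_sin_sq θ
  rw [rot, ← hP, star_add, star_add, star_one, star_smul, star_smul, hPs, hNs]
  simp only [Complex.star_def, Complex.conj_ofReal, smul_neg]
  simp only [add_mul, mul_add, one_mul, mul_one, mul_neg, smul_mul_assoc, mul_smul_comm, hPP, hPN,
    hNP, hNN, smul_neg]
  push_cast
  have : ((Real.sin θ : ℝ) : ℂ) ^ 2 = 1 - ((Real.cos θ : ℝ) : ℂ) ^ 2 := by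
    rw [← hcs]
    ring
  push_cast at this
  match_scalars
  · ring
  · linear_combination this
  · linear_combination this
  · ring

theorem rot_zero (x y : Fin n) (z : ℂ) : rot x y z 0 = 1 := by
  simp [rot]

theorem hasDerivAt_rot (x y : Fin n) (z : ℂ) (u v : Fin n) :
    HasDerivAt (fun θ => rot x y z θ u v) (rotGen x y z u v) 0 := by
  have hc : HasDerivAt (fun θ : ℝ => ((Real.cos θ - 1 : ℝ) : ℂ)) 0 0 := by
    simpa using ((Real.hasDerivAt_cos 0).sub_const 1).ofReal_comp
  have hs : HasDerivAt (fun θ : ℝ => ((Real.sin θ : ℝ) : ℂ)) 1 0 := by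
    simpa using (Real.hasDerivAt_sin 0).ofReal_comp
  have := ((hc.mul_const ((Matrix.single x x 1 + Matrix.single y y 1 :
    Matrix (Fin n) (Fin n) ℂ) u v)).const_add ((1 : Matrix (Fin n) (Fin n) ℂ) u v)).add
    (hs.mul_const (rotGen x y z u v))
  rw [zero_mul, one_mul, zero_add] at this
  exact this

variable {V : Setoid (Fin m)} {T : (Fin m → Fin n × Fin n) → ℂ}

/-- The action of the Lie algebra on an invariant tensor vanishes. -/
theorem BlockInvariant.sum_rotGen (hT : BlockInvariant V T) {x y : Fin n} (hxy : x ≠ y) {z : ℂ}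
    (hz : z * star z = 1) (c : Fin m → Fin n × Fin n) :
    ∑ t, ((∑ v, rotGen x y z (c t).1 v * T (Function.update c t (v, (c t).2))) +
      ∑ v, star (rotGen x y z (c t).2 v) * T (Function.update c t ((c t).1, v))) = 0 := by
  have key := sum_prod_deriv (T := T) (c := c)
    (G := fun θ p q => rot x y z θ p.1 q.1 * star (rot x y z θ p.2 q.2))
    (M := fun p q => rotGen x y z p.1 q.1 * star ((1 : Matrix (Fin n) (Fin n) ℂ) p.2 q.2) +
      (1 : Matrix (Fin n) (Fin n) ℂ) p.1 q.1 * star (rotGen x y z p.2 q.2))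
    (fun p q => by
      rw [rot_zero, Matrix.one_apply, Matrix.one_apply]
      by_cases h1 : p.1 = q.1 <;> by_cases h2 : p.2 = q.2 <;>
        simp [h1, h2, Prod.ext_iff, eq_comm (a := q.1), eq_comm (a := q.2)])
    (fun p q => by
      have := (hasDerivAt_rot x y z p.1 q.1).mul ((hasDerivAt_rot x y z p.2 q.2).star)
      rw [rot_zero] at this
      exact this)
    (fun θ => hT (fun _ => rot x y z θ) (fun _ => rot_mem_unitaryGroup hxy hz θ)
      (fun _ _ _ => rfl) c)
  rw [← key]
  refine Finset.sum_congr rfl fun t _ => ?_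
  simp_rw [add_mul, Finset.sum_add_distrib, Fintype.sum_prod_type]
  congr 1
  · refine Finset.sum_congr rfl fun v _ => ?_
    rw [Finset.sum_eq_single (c t).2]
    · simp
    · intro w _ hw
      simp [Matrix.one_apply_ne hw.symm]
    · simp
  · symm
    rw [Finset.sum_eq_single (c t).1]
    · simp
    · intro w _ hw
      simp [Matrix.one_apply_ne hw.symm]
    · simp

theorem BlockInvariant.sum_update (hT : BlockInvariant V T) {x y : Fin n} (hxy : x ≠ y)
    (c : Fin m → Fin n × Fin n) :
    ∑ t, (if (c t).1 = x then T (Function.update c t (y, (c t).2)) else 0) =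
      ∑ t, (if (c t).2 = y then T (Function.update c t ((c t).1, x)) else 0) := by
  have hgen : ∀ (z : ℂ) (u : Fin n) (F : Fin n → ℂ), ∑ v, rotGen x y z u v * F v =
      z * (if u = x then F y else 0) - star z * (if u = y then F x else 0) := by
    intro z u F
    simp only [rotGen, Matrix.sub_apply, sub_mul, Finset.sum_sub_distrib, Matrix.single_apply,
      ite_and, ite_mul, zero_mul, eq_comm (b := u)]
    split_ifs <;> simp
  have hgen' : ∀ (z : ℂ) (u : Fin n) (F : Fin n → ℂ), ∑ v, star (rotGen x y z u v) * F v =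
      star z * (if u = x then F y else 0) - z * (if u = y then F x else 0) := by
    intro z u F
    simp only [rotGen, Matrix.sub_apply, star_sub, sub_mul, Finset.sum_sub_distrib,
      Matrix.single_apply, ite_and, eq_comm (b := u)]
    split_ifs <;> simp [apply_ite (starRingEnd ℂ)]
  have h1 := hT.sum_rotGen hxy (z := 1) (by simp) c
  have h2 := hT.sum_rotGen hxy (z := Complex.I) (by simp) c
  simp only [hgen, hgen', Finset.sum_add_distrib, Finset.sum_sub_distrib, ← Finset.mul_sum] at h1 h2
  simp only [star_one, one_mul, Complex.star_def, Complex.conj_I] at h1 h2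
  linear_combination (1 / 2 : ℂ) * h1 - (1 / 2 : ℂ) * Complex.I * h2 + (1 / 2 : ℂ) *
    ((∑ t, (if (c t).1 = x then T (Function.update c t (y, (c t).2)) else 0)) +
      (∑ t, (if (c t).1 = y then T (Function.update c t (x, (c t).2)) else 0)) -
      (∑ t, (if (c t).2 = x then T (Function.update c t ((c t).1, y)) else 0)) -
      (∑ t, (if (c t).2 = y then T (Function.update c t ((c t).1, x)) else 0))) *
      Complex.I_mul_I

theorem BlockInvariant.apply_perm (hT : BlockInvariant V T) (σ : Equiv.Perm (Fin n))
    (c : Fin m → Fin n × Fin n) : T c = T (fun t => (σ (c t).1, σ (c t).2)) := by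
  let U : Matrix (Fin n) (Fin n) ℂ := Matrix.of fun x y => if σ x = y then 1 else 0
  have hU : U ∈ Matrix.unitaryGroup (Fin n) ℂ := by
    rw [Matrix.mem_unitaryGroup_iff]
    ext x y
    simp [U, Matrix.mul_apply, Matrix.one_apply, eq_comm]
  rw [hT (fun _ => U) (fun _ => hU) (fun _ _ _ => rfl) c,
    Finset.sum_eq_single (fun t => (σ (c t).1, σ (c t).2))]
  · simp [U]
  · intro a _ ha
    obtain ⟨t, ht⟩ := Function.ne_iff.1 ha
    rw [Finset.prod_eq_zero (Finset.mem_univ t), zero_mul]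
    by_cases h : σ (c t).1 = (a t).1
    · have : σ (c t).2 ≠ (a t).2 := fun h' => ht (Prod.ext h.symm h'.symm)
      simp [U, this]
    · simp [U, h]
  · simp

theorem BlockInvariant.apply_diagonal (hT : BlockInvariant V T) {d : Fin m → Fin n → ℂ}
    (hd : ∀ t x, d t x * star (d t x) = 1) (hdV : ∀ s t, V s t → d s = d t)
    (c : Fin m → Fin n × Fin n) : T c = (∏ t, (d t (c t).1 * star (d t (c t).2))) * T c := by
  conv_lhs => rw [hT (fun t => Matrix.diagonal (d t)) (fun t => by
    rw [Matrix.mem_unitaryGroup_iff, Matrix.star_eq_conjTranspose, Matrix.diagonal_conjTranspose,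
      Matrix.diagonal_mul_diagonal, ← Matrix.diagonal_one]
    exact congrArg Matrix.diagonal (funext fun x => hd t x))
    (fun s t hst => by rw [hdV s t hst]) c]
  rw [Finset.sum_eq_single c]
  · simp
  · intro a _ ha
    obtain ⟨t, ht⟩ := Function.ne_iff.1 ha
    rw [Finset.prod_eq_zero (Finset.mem_univ t), zero_mul]
    by_cases h : (c t).1 = (a t).1
    · have : (c t).2 ≠ (a t).2 := fun h' => ht (Prod.ext h.symm h'.symm)
      simp [this]
    · simp [h]
  · simp

/-- A block-invariant tensor vanishes at `(i, j)` with `i` injective unless every value of `i`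
is taken by `j` in the same block. -/
theorem BlockInvariant.exists_eq (hT : BlockInvariant V T) {i j : Fin m → Fin n}
    (hi : Function.Injective i) (h : T (fun t => (i t, j t)) ≠ 0) (t : Fin m) :
    ∃ s, V s t ∧ j s = i t := by
  by_contra! hcon
  let d : Fin m → Fin n → ℂ := fun s x => if V s t ∧ x = i t then -1 else 1
  have h1 := hT.apply_diagonal (d := d)
    (fun s x => by
      by_cases hs : V s t ∧ x = i t <;> simp [d, hs])
    (fun s s' hss => by
      have : V s t ↔ V s' t := ⟨V.trans (V.symm hss), V.trans hss⟩
      simp [d, this]) (fun t => (i t, j t))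
  rw [Finset.prod_eq_single t] at h1
  · have h2 : d t (i t) = -1 := if_pos ⟨V.refl t, rfl⟩
    have h3 : d t (j t) = 1 := if_neg fun h => hcon t h.1 h.2
    simp only [h2, h3, star_one] at h1
    exact h (by linear_combination (1 / 2 : ℂ) * h1)
  · intro s _ hs
    have h2 : d s (i s) = 1 := if_neg fun h => hs (hi h.2)
    have h3 : d s (j s) = 1 := if_neg fun h => hcon s h.1 h.2
    simp [h2, h3]
  · simp

/-- The coefficient of the permutation `π` in an invariant tensor. -/
def permCoeff (hmn : m ≤ n) (T : (Fin m → Fin n × Fin n) → ℂ) (π : Equiv.Perm (Fin m)) : ℂ :=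
  T (fun t => (Fin.castLE hmn t, Fin.castLE hmn (π t)))

theorem BlockInvariant.permCoeff_eq_zero (hT : BlockInvariant V T) (hmn : m ≤ n)
    {π : Equiv.Perm (Fin m)} (hπ : ¬ permLePartition π V) : permCoeff hmn T π = 0 := by
  by_contra h
  refine hπ fun s => ?_
  obtain ⟨s', hst, hj⟩ := hT.exists_eq (Fin.castLE_injective hmn) h (π s)
  rw [π.injective (Fin.castLE_injective hmn hj)] at hst
  exact hst

/-- An invariant tensor is a linear combination of permutations. -/
theorem BlockInvariant.eq_sum (hT : BlockInvariant V T) (hmn : m ≤ n) (i j : Fin m → Fin n) :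
    T (fun t => (i t, j t)) =
      ∑ π : Equiv.Perm (Fin m), if j = i ∘ π then permCoeff hmn T π else 0 := by
  induction hd : m - (Finset.univ.image i).card using Nat.strong_induction_on generalizing i j with
  | _ d ih =>
  by_cases hi : Function.Injective i
  · by_cases hj : ∃ π : Equiv.Perm (Fin m), j = i ∘ π
    · obtain ⟨π, rfl⟩ := hj
      rw [Finset.sum_eq_single π, if_pos rfl]
      · obtain ⟨σ, hσ⟩ : ∃ σ : Equiv.Perm (Fin n), ∀ t, σ (i t) = Fin.castLE hmn t := by
          obtain ⟨σ, hσ⟩ := Equiv.Perm.exists_extending_pair i (Fin.castLE hmn) hi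
            (Fin.castLE_injective hmn)
          exact ⟨σ, hσ⟩
        rw [hT.apply_perm σ]
        simp [hσ, permCoeff]
      · intro ρ _ hρ
        refine if_neg fun h => hρ (Equiv.ext fun t => hi ?_)
        exact (congrFun h t).symm
      · simp
    · rw [Finset.sum_eq_zero fun π _ => if_neg fun h => hj ⟨π, h⟩]
      by_contra h
      choose f _ hf using hT.exists_eq hi h
      have hinj : Function.Injective f := fun s t hst => hi (by rw [← hf s, ← hf t, hst])
      let e := Equiv.ofBijective f (Finite.injective_iff_bijective.1 hinj)
      refine hj ⟨e.symm, funext fun t => ?_⟩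
      have := hf (e.symm t)
      rw [show f (e.symm t) = t from e.apply_symm_apply t] at this
      exact this
  · obtain ⟨t₁, t₀, heq, hne⟩ : ∃ t₁ t₀, i t₁ = i t₀ ∧ t₁ ≠ t₀ := by
      simpa [Function.Injective] using hi
    obtain ⟨y, hy⟩ : ∃ y, ∀ t, i t ≠ y := by
      by_contra! hcon
      have h1 := Fintype.card_le_of_surjective i hcon
      rw [Fintype.card_fin, Fintype.card_fin] at h1
      obtain rfl := le_antisymm h1 hmn
      exact hi (Finite.injective_iff_surjective.2 hcon)
    set i' := Function.update i t₀ y with hi'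
    have hi'0 : i' t₀ = y := Function.update_self _ _ _
    have hne' : ∀ t, t ≠ t₀ → i' t = i t := fun t ht => Function.update_of_ne ht _ _
    have hi'y : ∀ t, i' t = y ↔ t = t₀ := fun t =>
      ⟨fun h => by_contra fun ht => hy t (by rw [← hne' t ht, h]), fun h => h ▸ hi'0⟩
    have hcard : (Finset.univ.image i).card < (Finset.univ.image i').card := by
      refine Finset.card_lt_card ?_
      rw [Finset.ssubset_iff_of_subset]
      · exact ⟨y, by simpa using ⟨t₀, hi'0⟩, by simpa using hy⟩
      · intro x hx
        obtain ⟨t, -, rfl⟩ := Finset.mem_image.1 hx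
        rcases eq_or_ne t t₀ with rfl | ht
        · exact Finset.mem_image.2 ⟨t₁, Finset.mem_univ _, by rw [hne' t₁ hne, heq]⟩
        · exact Finset.mem_image.2 ⟨t, Finset.mem_univ _, hne' t ht⟩
    have hle : (Finset.univ.image i').card ≤ m :=
      Finset.card_image_le.trans_eq (Finset.card_fin m)
    have hrel := hT.sum_update (x := y) (y := i t₀) (hy t₀).symm (fun t => (i' t, j t))
    have hupd : Function.update (fun t => (i' t, j t)) t₀ (i t₀, j t₀) =
        fun t => (i t, j t) := by
      funext t
      rcases eq_or_ne t t₀ with rfl | ht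
      · simp
      · rw [Function.update_of_ne ht, hne' t ht]
    have hupd' : ∀ t, Function.update (fun t => (i' t, j t)) t (i' t, y) =
        fun s => (i' s, Function.update j t y s) := by
      intro t
      funext s
      rcases eq_or_ne s t with rfl | hs
      · simp
      · rw [Function.update_of_ne hs, Function.update_of_ne hs]
    simp only [hi'y, hupd'] at hrel
    rw [Finset.sum_ite_eq' Finset.univ t₀, if_pos (Finset.mem_univ _), hupd] at hrel
    rw [hrel]
    simp only [ih _ (by omega) i' _ rfl]
    have hiff : ∀ (t : Fin m) (π : Equiv.Perm (Fin m)),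
        (j t = i t₀ ∧ Function.update j t y = i' ∘ π) ↔ (t = π⁻¹ t₀ ∧ j = i ∘ π) := by
      intro t π
      constructor
      · rintro ⟨h1, h2⟩
        have ht : π t = t₀ := by
          have := congrFun h2 t
          rw [Function.update_self] at this
          exact (hi'y _).1 this.symm
        refine ⟨by rw [← ht]; simp, funext fun s => ?_⟩
        rcases eq_or_ne s t with rfl | hs
        · rw [h1, Function.comp_apply, ht]
        · have := congrFun h2 s
          rw [Function.update_of_ne hs, Function.comp_apply,
            hne' _ fun h => hs (π.injective (h.trans ht.symm))] at this
          exact this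
      · rintro ⟨rfl, rfl⟩
        refine ⟨by simp, funext fun s => ?_⟩
        rcases eq_or_ne s (π⁻¹ t₀) with rfl | hs
        · simp [hi'0]
        · rw [Function.update_of_ne hs, Function.comp_apply, Function.comp_apply, hne']
          rintro h
          exact hs (by rw [← h]; simp)
    calc _ = ∑ t, ∑ π : Equiv.Perm (Fin m),
          if t = π⁻¹ t₀ ∧ j = i ∘ π then permCoeff hmn T π else 0 := by
          refine Finset.sum_congr rfl fun t _ => ?_
          simp only [← hiff, ite_and]
          split_ifs <;> simp
      _ = _ := by
          rw [Finset.sum_comm]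
          refine Finset.sum_congr rfl fun π _ => ?_
          simp only [ite_and]
          rw [Finset.sum_ite_eq' Finset.univ (π⁻¹ t₀), if_pos (Finset.mem_univ _)]

end InvariantTensors

section TracePowers

variable {n : ℕ} [Ring A]

theorem pow_succ_apply_eq_sum (X : Matrix (Fin n) (Fin n) A) (q : ℕ) (x y : Fin n) :
    (X ^ (q + 1)) x y = ∑ f : Fin q → Fin n, (List.ofFn fun j : Fin (q + 1) =>
      X ((Fin.cons x f : Fin (q + 1) → Fin n) j) ((Fin.snoc f y : Fin (q + 1) → Fin n) j)).prod := by
  induction q generalizing x with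
  | zero => simp [Fin.snoc]
  | succ q ih =>
    rw [pow_succ', Matrix.mul_apply, ← (Fin.consEquiv fun _ : Fin (q + 1) => Fin n).sum_comp,
      Fintype.sum_prod_type]
    refine Finset.sum_congr rfl fun z _ => ?_
    rw [ih, Finset.mul_sum]
    refine Finset.sum_congr rfl fun f _ => ?_
    rw [List.ofFn_succ (n := q + 1), List.prod_cons]
    have hsnoc : (Fin.snoc ((Fin.consEquiv fun _ : Fin (q + 1) => Fin n) (z, f)) y :
        Fin (q + 2) → Fin n) = Fin.cons z (Fin.snoc f y : Fin (q + 1) → Fin n) :=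
      (Fin.cons_snoc_eq_snoc_cons z f y).symm
    simp only [hsnoc, Fin.cons_zero, Fin.cons_succ]
    rfl

theorem trace_pow_eq_sum (X : Matrix (Fin n) (Fin n) A) {q : ℕ} (hq : 1 ≤ q) :
    Matrix.trace (X ^ q) = ∑ g : Fin q → Fin n,
      (List.ofFn fun j : Fin q => X (g j) (g (finRotate q j))).prod := by
  obtain ⟨q, rfl⟩ := Nat.exists_eq_add_of_le' hq
  rw [← (Fin.consEquiv fun _ : Fin (q + 1) => Fin n).sum_comp, Fintype.sum_prod_type]
  refine Finset.sum_congr rfl fun x _ => ?_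
  rw [Matrix.diag_apply, pow_succ_apply_eq_sum]
  refine Finset.sum_congr rfl fun f _ => ?_
  congr 2
  funext j
  simp only [Fin.consEquiv_apply]
  congr 1
  refine Fin.lastCases ?_ (fun i => ?_) j
  · rw [Fin.snoc_last, finRotate_last, Fin.cons_zero]
  · rw [Fin.snoc_castSucc, finRotate_apply, Fin.coeSucc_eq_succ, Fin.cons_succ]

end TracePowers

section Blocks

variable {l kk : ℕ} {p : Fin l → ℕ}

theorem psum_succ (p : Fin l → ℕ) (i : Fin l) : psum p (i + 1) = psum p i + p i := by
  have h : ∀ x : Fin l, (if (x : ℕ) < i + 1 then p x else 0) =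
      (if (x : ℕ) < i then p x else 0) + if x = i then p x else 0 := by
    intro x
    simp only [Fin.ext_iff]
    split_ifs <;> omega
  simp only [psum, h, Finset.sum_add_distrib, Finset.sum_ite_eq', Finset.mem_univ, if_true]

theorem psum_mono (p : Fin l → ℕ) {i j : ℕ} (h : i ≤ j) : psum p i ≤ psum p j := by
  refine Finset.sum_le_sum fun x _ => ?_
  split_ifs <;> omega

theorem psum_eq_sum (p : Fin l → ℕ) : psum p l = ∑ i, p i := by
  simp [psum]

/-- Consecutive blocks of sizes `p i` fill up `Fin kk`. -/
theorem exists_blockEquiv (hkk : psum p l = kk) :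
    ∃ e : (Σ i : Fin l, Fin (p i)) ≃ Fin kk, ∀ i j, (e ⟨i, j⟩ : ℕ) = psum p i + j := by
  rw [psum_eq_sum] at hkk
  refine ⟨finSigmaFinEquiv.trans (finCongr hkk), fun i j => ?_⟩
  rw [Equiv.trans_apply, finCongr_apply, Fin.val_cast, finSigmaFinEquiv_apply, psum]
  congr 1
  refine Fintype.sum_of_injective (Fin.castLE i.2.le) (Fin.castLE_injective _) _ _
    (fun x hx => if_neg fun hlt => hx ⟨⟨x, hlt⟩, rfl⟩) fun y => ?_
  exact (if_pos y.2).symm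

variable {e : (Σ i : Fin l, Fin (p i)) ≃ Fin kk}

theorem ordProd_blocks [Monoid A] (he : ∀ i j, (e ⟨i, j⟩ : ℕ) = psum p i + j) (a : Fin kk → A)
    (S : Set (Fin l)) :
    ordProd a {t | (e.symm t).1 ∈ S} =
      ordProd (fun i => (List.ofFn fun j => a (e ⟨i, j⟩)).prod) S := by
  have hL : (List.finRange kk).filter (fun t => decide ((e.symm t).1 ∈ S)) =
      ((List.finRange l).filter (fun i => decide (i ∈ S))).flatMap
        (fun i => (List.finRange (p i)).map fun j => e ⟨i, j⟩) := by
    have h1 : ((List.finRange kk).filter (fun t => decide ((e.symm t).1 ∈ S))).Pairwise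
        (· < ·) := (List.pairwise_lt_finRange kk).filter _
    have h2 : (((List.finRange l).filter (fun i => decide (i ∈ S))).flatMap
        (fun i => (List.finRange (p i)).map fun j => e ⟨i, j⟩)).Pairwise (· < ·) := by
      rw [List.pairwise_flatMap]
      refine ⟨fun i _ => ?_, ((List.pairwise_lt_finRange l).filter _).imp ?_⟩
      · rw [List.pairwise_map]
        refine (List.pairwise_lt_finRange _).imp fun {j j'} hj => ?_
        rw [Fin.lt_def, he, he]
        exact Nat.add_lt_add_left hj _
      · intro i i' hii x hx y hy
        obtain ⟨j, -, rfl⟩ := List.mem_map.1 hx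
        obtain ⟨j', -, rfl⟩ := List.mem_map.1 hy
        rw [Fin.lt_def, he, he]
        have h3 := psum_succ p i
        have h4 : psum p (i + 1) ≤ psum p i' := psum_mono p hii
        have := j.2
        omega
    refine List.Perm.eq_of_pairwise' h1 h2
      ((List.perm_ext_iff_of_nodup h1.nodup h2.nodup).2 fun t => ?_)
    simp only [List.mem_filter, List.mem_finRange, true_and, decide_eq_true_eq, List.mem_flatMap,
      List.mem_map]
    constructor
    · intro h
      exact ⟨_, h, _, e.apply_symm_apply t⟩
    · rintro ⟨i, hi, j, rfl⟩
      rwa [e.symm_apply_apply]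
  unfold ordProd
  simp only [Set.mem_ofPred_eq]
  rw [hL]
  generalize (List.finRange l).filter (fun i => decide (i ∈ S)) = L
  induction L with
  | nil => simp
  | cons i L ih =>
    rw [List.flatMap_cons, List.map_append, List.prod_append, ih, List.map_cons, List.prod_cons,
      List.map_map, List.ofFn_eq_map]
    rfl

theorem blockIndex_surjective (hp : ∀ i, 1 ≤ p i) (e : (Σ i : Fin l, Fin (p i)) ≃ Fin kk) :
    Function.Surjective fun t => (e.symm t).1 :=
  fun i => ⟨e ⟨i, ⟨0, hp i⟩⟩, by simp⟩

theorem momentV_blocks {R : Type*} [CommRing R] [Monoid A] (E : A → R) (hp : ∀ i, 1 ≤ p i)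
    (he : ∀ i j, (e ⟨i, j⟩ : ℕ) = psum p i + j) (a : Fin kk → A) (U : Setoid (Fin l)) :
    momentV E (Setoid.comap (fun t => (e.symm t).1) U) a =
      momentV E U (fun i => (List.ofFn fun j => a (e ⟨i, j⟩)).prod) := by
  have hb := blockIndex_surjective hp e
  refine (finprod_mem_eq_of_bijOn (fun B => (fun t => (e.symm t).1) ⁻¹' B) ⟨?_, ?_, ?_⟩ ?_).symm
  · rintro _ ⟨i, rfl⟩
    obtain ⟨t, rfl⟩ := hb i
    exact ⟨t, rfl⟩
  · exact hb.preimage_injective.injOn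
  · rintro _ ⟨t, rfl⟩
    exact ⟨_, U.mem_classes (e.symm t).1, rfl⟩
  · intro B _
    exact congrArg E (ordProd_blocks he a B).symm

/-- The cumulants of products (formula of Leonov and Shiryaev). -/
theorem cumulant_blocks [Ring A] [Algebra ℂ A] (E : A →ₗ[ℂ] ℂ)
    {k : ∀ {l : ℕ}, Setoid (Fin l) → (Fin l → A) → ℂ} (hk : IsCumulant (⇑E) @k)
    (hp : ∀ i, 1 ≤ p i) (he : ∀ i j, (e ⟨i, j⟩ : ℕ) = psum p i + j) (a : Fin kk → A) :
    k ⊤ (fun i => (List.ofFn fun j => a (e ⟨i, j⟩)).prod) =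
      ∑ V : Setoid (Fin kk), if V ⊔ Setoid.ker (fun t => (e.symm t).1) = ⊤ then k V a else 0 := by
  set b : Fin kk → Fin l := fun t => (e.symm t).1 with hb
  obtain ⟨sec, hsec⟩ := (blockIndex_surjective hp e).hasRightInverse
  have hb_sec : ∀ i, b (sec i) = i := hsec
  have hker : ∀ V t, (V ⊔ Setoid.ker b) (sec (b t)) t := fun V t =>
    (le_sup_right : Setoid.ker b ≤ V ⊔ Setoid.ker b) (hb_sec (b t))
  let φ : Setoid (Fin kk) → Setoid (Fin l) := fun V => Setoid.comap sec (V ⊔ Setoid.ker b)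
  have hφ : ∀ V U, φ V ≤ U ↔ V ≤ Setoid.comap b U := by
    intro V U
    constructor
    · intro h x y hxy
      have hxy' : (V ⊔ Setoid.ker b) x y := (le_sup_left : V ≤ V ⊔ Setoid.ker b) hxy
      have hsec' : (V ⊔ Setoid.ker b) (sec (b x)) (sec (b y)) :=
        Setoid.trans' _ (Setoid.trans' _ (hker V x) hxy') (Setoid.symm' _ (hker V y))
      exact h hsec'
    · intro h i j hij
      have h1 : V ⊔ Setoid.ker b ≤ Setoid.comap b U := by
        refine sup_le h fun x y hxy => ?_
        change U (b x) (b y)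
        rw [show b x = b y from hxy]
      have h2 : U (b (sec i)) (b (sec j)) := h1 hij
      rwa [hb_sec, hb_sec] at h2
  have hφtop : ∀ V, φ V = ⊤ ↔ V ⊔ Setoid.ker b = ⊤ := by
    intro V
    constructor
    · intro h
      rw [eq_top_iff]
      intro x y _
      have : φ V (b x) (b y) := h ▸ trivial
      have hxy : (V ⊔ Setoid.ker b) (sec (b x)) (sec (b y)) := this
      exact Setoid.trans' _ (Setoid.trans' _ (Setoid.symm' _ (hker V x)) hxy) (hker V y)
    · intro h
      change Setoid.comap sec (V ⊔ Setoid.ker b) = ⊤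
      rw [h]
      exact eq_top_iff.2 fun _ _ _ => trivial
  simp only [← hφtop]
  refine eq_of_sum_le_eq (f := fun U => k U (fun i => (List.ofFn fun j => a (e ⟨i, j⟩)).prod))
    (g := fun U => ∑ V : Setoid (Fin kk), if φ V = U then k V a else 0) ⊤ fun U _ => ?_
  rw [hk l U, ← momentV_blocks _ hp he, ← hk kk, Finset.sum_filter, Finset.sum_comm]
  refine Finset.sum_congr rfl fun V _ => ?_
  rw [Finset.sum_ite_eq]
  simp only [Finset.mem_filter, Finset.mem_univ, true_and, hφ]
  rfl

variable {γ : Equiv.Perm (Fin kk)}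

theorem IsCycleType.apply_blocks (hγ : IsCycleType p γ)
    (he : ∀ i j, (e ⟨i, j⟩ : ℕ) = psum p i + j) (i : Fin l) (j : Fin (p i)) :
    γ (e ⟨i, j⟩) = e ⟨i, finRotate (p i) j⟩ := by
  have hrot : ∀ {q : ℕ} (j : Fin q), (finRotate q j : ℕ) =
      if (j : ℕ) + 1 < q then (j : ℕ) + 1 else 0 := by
    intro q j
    rcases q with _ | q
    · exact j.elim0
    · split_ifs with h
      · exact coe_finRotate_of_ne_last fun hj => by
          rw [hj, Fin.val_last] at h
          omega
      · obtain rfl : j = Fin.last q := Fin.ext (by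
          have := j.2
          rw [Fin.val_last]
          omega)
        rw [finRotate_last]
        rfl
  apply Fin.ext
  rw [he, hrot]
  have hj := j.2
  have hs := psum_succ p i
  split_ifs with h
  · rw [hγ.2.1 i i.2 (e ⟨i, j⟩) (by rw [he]; omega) (by rw [he]; omega), he]
    omega
  · rw [hγ.2.2 i i.2 (e ⟨i, j⟩) (by rw [he]; omega)]
    omega

theorem IsCycleType.cycleSetoid_eq (hγ : IsCycleType p γ)
    (he : ∀ i j, (e ⟨i, j⟩ : ℕ) = psum p i + j) :
    cycleSetoid γ = Setoid.ker (fun t => (e.symm t).1) := by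
  refine le_antisymm (cycleSetoid_le_iff.2 fun t => ?_) ?_
  · obtain ⟨⟨i, j⟩, rfl⟩ := e.surjective t
    change (e.symm _).1 = (e.symm _).1
    rw [hγ.apply_blocks he]
    simp
  · have key : ∀ (i : Fin l) (j : ℕ) (hj : j < p i),
        cycleSetoid γ (e ⟨i, ⟨0, by omega⟩⟩) (e ⟨i, ⟨j, hj⟩⟩) := by
      intro i j
      induction j with
      | zero => exact fun _ => Setoid.refl' _ _
      | succ j ih =>
        intro hj
        have h1 : γ (e ⟨i, ⟨j, by omega⟩⟩) = e ⟨i, ⟨j + 1, hj⟩⟩ := by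
          have hs := psum_succ p i
          apply Fin.ext
          rw [hγ.2.1 i i.2 _ (by rw [he]; omega) (by rw [he]; simp only []; omega), he, he]
          rfl
        rw [← h1]
        exact Setoid.trans' _ (ih (by omega)) (permLePartition_cycleSetoid γ _)
    intro s t hst
    obtain ⟨⟨i, j⟩, rfl⟩ := e.surjective s
    obtain ⟨⟨i', j'⟩, rfl⟩ := e.surjective t
    have hii : i = i' := by simpa [Setoid.ker_def] using hst
    subst hii
    exact Setoid.trans' _ (Setoid.symm' _ (key i j j.2)) (key i j' j'.2)

theorem IsCycleType.numCycles_eq (hγ : IsCycleType p γ) (hp : ∀ i, 1 ≤ p i) :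
    numCycles γ = l := by
  obtain ⟨e, he⟩ := exists_blockEquiv hγ.1
  rw [numCycles, hγ.cycleSetoid_eq he, numBlocks_ker (blockIndex_surjective hp e),
    Fintype.card_fin]

end Blocks

section Expansion

variable {m n : ℕ}

theorem card_comp_eq_self (σ : Equiv.Perm (Fin m)) (n : ℕ) :
    Fintype.card {x : Fin m → Fin n // x ∘ σ = x} = n ^ numCycles σ := by
  rw [numCycles, numBlocks_eq_card, ← Fintype.card_fin n, ← Fintype.card_fun, Fintype.card_fin n]
  refine Fintype.card_congr ((Equiv.subtypeEquivRight fun x => ?_).trans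
    (Setoid.liftEquiv (cycleSetoid σ)))
  rw [cycleSetoid_le_iff, funext_iff]
  exact forall_congr' fun t => eq_comm

theorem sum_comp_eq_comp (γ π : Equiv.Perm (Fin m)) (n : ℕ) (c : ℂ) :
    ∑ x : Fin m → Fin n, (if x ∘ γ = x ∘ π then c else 0) =
      (n : ℂ) ^ numCycles (π⁻¹ * γ) * c := by
  have h : ∀ x : Fin m → Fin n,
      x ∘ γ = x ∘ π ↔ (Equiv.arrowCongr π⁻¹ (Equiv.refl _) x) ∘ (π⁻¹ * γ) =
        Equiv.arrowCongr π⁻¹ (Equiv.refl _) x := by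
    intro x
    simp only [funext_iff, Function.comp_apply, Equiv.arrowCongr_apply, Equiv.coe_refl, id_eq,
      Equiv.Perm.mul_apply]
    refine forall_congr' fun t => ?_
    simp [← Equiv.Perm.inv_def]
  simp only [h]
  rw [(Equiv.arrowCongr π⁻¹ (Equiv.refl (Fin n))).sum_comp
      (fun y : Fin m → Fin n => if y ∘ (π⁻¹ * γ : Equiv.Perm (Fin m)) = y then c else 0),
    ← Finset.sum_filter, Finset.sum_const, ← Fintype.card_subtype, card_comp_eq_self,
    nsmul_eq_mul, Nat.cast_pow]

variable [Ring A] [Algebra ℂ A] (E : A →ₗ[ℂ] ℂ)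
  {k : ∀ {l : ℕ}, Setoid (Fin l) → (Fin l → A) → ℂ} {X : Matrix (Fin n) (Fin n) A}

theorem blockInvariant_cumulant (hk : IsCumulant (⇑E) @k) (hX : UnitarilyInvariant (⇑E) X)
    (V : Setoid (Fin m)) :
    BlockInvariant V (fun c : Fin m → Fin n × Fin n => k V fun t => X (c t).1 (c t).2) :=
  fun _ hU hUV c => cumulant_eq_sum E hk hX hU hUV (fun t => (c t).1) (fun t => (c t).2)

variable {l kk : ℕ} {p : Fin l → ℕ} {γ : Equiv.Perm (Fin kk)}

theorem cumulant_trace_eq_sum (hk : IsCumulant (⇑E) @k) (hp : ∀ i, 1 ≤ p i)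
    (hγ : IsCycleType p γ) :
    k ⊤ (fun i : Fin l => ncTrace (X ^ p i)) =
      ((n : ℂ)⁻¹) ^ l * ∑ V : Setoid (Fin kk), if V ⊔ cycleSetoid γ = ⊤ then
        ∑ x : Fin kk → Fin n, k V (fun t => X (x t) (x (γ t))) else 0 := by
  obtain ⟨e, he⟩ := exists_blockEquiv hγ.1
  have h1 : (fun i : Fin l => ncTrace (X ^ p i)) = fun i => (n : ℂ)⁻¹ •
      ∑ g : Fin (p i) → Fin n, (List.ofFn fun j => X (g j) (g (finRotate (p i) j))).prod :=
    funext fun i => congrArg _ (trace_pow_eq_sum X (hp i))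
  rw [h1]
  change cumulantMultilinear E hk ⊤ _ = _
  rw [MultilinearMap.map_smul_univ, MultilinearMap.map_sum, Finset.prod_const, Finset.card_univ,
    Fintype.card_fin, smul_eq_mul]
  congr 1
  let F : (Fin kk → Fin n) ≃ (∀ i : Fin l, Fin (p i) → Fin n) :=
    (Equiv.arrowCongr e.symm (Equiv.refl (Fin n))).trans (Equiv.piCurry fun _ _ => Fin n)
  rw [← F.sum_comp]
  have h2 : ∀ x : Fin kk → Fin n, cumulantMultilinear E hk ⊤ (fun i : Fin l =>
      (List.ofFn fun j => X (F x i j) (F x i (finRotate (p i) j))).prod) =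
        ∑ V : Setoid (Fin kk), if V ⊔ cycleSetoid γ = ⊤ then
          k V (fun t => X (x t) (x (γ t))) else 0 := by
    intro x
    rw [hγ.cycleSetoid_eq he, ← cumulant_blocks E hk hp he]
    simp only [hγ.apply_blocks he]
    rfl
  simp only [h2]
  rw [Finset.sum_comm]
  refine Finset.sum_congr rfl fun V _ => ?_
  split_ifs <;> simp

theorem cumulant_ncTrace (hk : IsCumulant (⇑E) @k) (hX : UnitarilyInvariant (⇑E) X)
    (hp : ∀ i, 1 ≤ p i) (hγ : IsCycleType p γ) (h : kk ≤ n) (hn : n ≠ 0) :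
    k ⊤ (fun i : Fin l => ncTrace (X ^ p i)) =
      ∑ V : Setoid (Fin kk), ∑ π : Equiv.Perm (Fin kk),
        if permLePartition π V ∧ V ⊔ cycleSetoid (π⁻¹ * γ) = ⊤ then
          (n : ℂ) ^ ((numCycles (π⁻¹ * γ) : ℤ) - l) * kappa @k X h V π else 0 := by
  have hn' : (n : ℂ) ≠ 0 := Nat.cast_ne_zero.2 hn
  rw [cumulant_trace_eq_sum E hk hp hγ, Finset.mul_sum]
  refine Finset.sum_congr rfl fun V _ => ?_
  have hV := blockInvariant_cumulant (m := kk) E hk hX V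
  have hx : ∀ x : Fin kk → Fin n, k V (fun t => X (x t) (x (γ t))) =
      ∑ π : Equiv.Perm (Fin kk), if x ∘ γ = x ∘ π then kappa @k X h V π else 0 :=
    fun x => hV.eq_sum h x (x ∘ γ)
  simp only [hx]
  rw [Finset.sum_comm]
  simp only [sum_comp_eq_comp]
  have hsum : ∀ c : ℂ, (n : ℂ)⁻¹ ^ l * (if V ⊔ cycleSetoid γ = ⊤ then c else 0) =
      if V ⊔ cycleSetoid γ = ⊤ then (n : ℂ)⁻¹ ^ l * c else 0 := fun c => by
    split_ifs <;> simp
  have hite : ∀ F : Equiv.Perm (Fin kk) → ℂ,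
      (if V ⊔ cycleSetoid γ = ⊤ then ∑ π, F π else 0) =
        ∑ π, if V ⊔ cycleSetoid γ = ⊤ then F π else 0 := fun F => by
    split_ifs <;> simp
  rw [hsum, Finset.mul_sum, hite]
  refine Finset.sum_congr rfl fun π _ => ?_
  by_cases hπ : permLePartition π V
  · have hsup : V ⊔ cycleSetoid γ = V ⊔ cycleSetoid (π⁻¹ * γ) := by
      refine le_antisymm (sup_le le_sup_left ?_) (sup_le le_sup_left ?_)
      · rw [cycleSetoid_le_iff]
        have := (hπ.mono (le_sup_left : V ≤ V ⊔ cycleSetoid (π⁻¹ * γ))).mul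
          ((permLePartition_cycleSetoid (π⁻¹ * γ)).mono le_sup_right)
        rwa [mul_inv_cancel_left] at this
      · rw [cycleSetoid_le_iff]
        exact (hπ.inv.mono le_sup_left).mul ((permLePartition_cycleSetoid γ).mono le_sup_right)
    rw [hsup]
    simp only [hπ, true_and]
    refine if_congr Iff.rfl ?_ rfl
    rw [zpow_sub₀ hn', zpow_natCast, zpow_natCast, div_eq_mul_inv, inv_pow]
    ring
  · have h0 : kappa @k X h V π = 0 := hV.permCoeff_eq_zero h hπ
    simp [h0]

theorem ppLen_add_le {V : Setoid (Fin kk)} {π : Equiv.Perm (Fin kk)} (hk : 0 < kk)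
    (hπ : permLePartition π V) (hV : V ⊔ cycleSetoid (π⁻¹ * γ) = ⊤) :
    ppLen ⊤ γ ≤ ppLen V π + permLen (π⁻¹ * γ) := by
  have h := numCycles_mul_add_le (π⁻¹ * γ) hπ
  rw [mul_inv_cancel_left, hV, numBlocks_top hk] at h
  rw [ppLen, ppLen, permLen, numBlocks_top hk]
  omega

end Expansion

open scoped ComplexOrder in
/-- If all rescaled cumulants of entries of a sequence of unitarily invariant
random matrices with noncommutative entries converge (microscopic convergence), then the rescaled
cumulants of normalized traces of powers converge as well, and
`M_{p₁,…,p_l} = Σ_{(V,π) ≤ (1_k,γ)} K_{(V,π)}`. -/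
theorem moments_cumulants_formula_higher_order
    {A : ℕ → Type*} [∀ n, Ring (A n)] [∀ n, Algebra ℂ (A n)] [∀ n, StarRing (A n)]
    (E : ∀ n, A n →ₗ[ℂ] ℂ) (hE1 : ∀ n, E n 1 = 1)
    (hEpos : ∀ n (x : A n), x ≠ 0 → 0 < E n (star x * x))
    (k : ∀ n, ∀ {l : ℕ}, Setoid (Fin l) → (Fin l → A n) → ℂ)
    (hk : ∀ n, IsCumulant (⇑(E n)) (@k n))
    (X : ∀ n, Matrix (Fin n) (Fin n) (A n))
    (hX : ∀ n, UnitarilyInvariant (⇑(E n)) (X n))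
    (K : ∀ {m : ℕ}, Setoid (Fin m) → Equiv.Perm (Fin m) → ℂ)
    (hK : ∀ (m : ℕ) (V : Setoid (Fin m)) (π : Equiv.Perm (Fin m)), permLePartition π V →
      Tendsto (fun n : ℕ => (n : ℂ) ^ (ppLen V π) * kappaSeq (fun n => @k n) X V π n)
        atTop (nhds (K V π)))
    {l : ℕ} (hl : 1 ≤ l) (p : Fin l → ℕ) (hp : ∀ i, 1 ≤ p i)
    {kk : ℕ} (hkk : psum p l = kk)
    (γ : Equiv.Perm (Fin kk)) (hγ : IsCycleType p γ) :
    Tendsto (fun n : ℕ => (n : ℂ) ^ (2 * (l : ℤ) - 2) *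
        k n ⊤ (fun i : Fin l => ncTrace ((X n) ^ (p i))))
      atTop
      (nhds (∑ V : Setoid (Fin kk), ∑ π : Equiv.Perm (Fin kk),
        if permLePartition π V ∧ ppLe V π ⊤ γ then K V π else 0)) := by
  have hkk0 : 0 < kk := by
    obtain rfl := hkk
    rw [psum_eq_sum]
    exact Finset.sum_pos (fun i _ => hp i) ⟨⟨0, hl⟩, Finset.mem_univ _⟩
  have hlen : ppLen ⊤ γ = kk + l - 2 := by
    rw [ppLen, hγ.numCycles_eq hp, numBlocks_top hkk0]
    push_cast
    ring
  have hlim : Tendsto (fun n : ℕ => ∑ V : Setoid (Fin kk), ∑ π : Equiv.Perm (Fin kk),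
      if permLePartition π V ∧ V ⊔ cycleSetoid (π⁻¹ * γ) = ⊤ then
        (n : ℂ) ^ (ppLen ⊤ γ - (ppLen V π + permLen (π⁻¹ * γ))) *
          ((n : ℂ) ^ ppLen V π * kappaSeq (fun n => @k n) X V π n) else 0) atTop
      (nhds (∑ V : Setoid (Fin kk), ∑ π : Equiv.Perm (Fin kk),
        if permLePartition π V ∧ ppLe V π ⊤ γ then K V π else 0)) := by
    refine tendsto_finsetSum _ fun V _ => tendsto_finsetSum _ fun π _ => ?_
    by_cases h : permLePartition π V ∧ V ⊔ cycleSetoid (π⁻¹ * γ) = ⊤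
    · simp only [h.1, h.2, ppLe, true_and, and_self, if_true]
      have hle := ppLen_add_le hkk0 h.1 h.2
      split_ifs with heq
      · simpa [heq] using hK kk V π h.1
      · obtain ⟨r, hr⟩ : ∃ r : ℕ,
            ppLen ⊤ γ - (ppLen V π + permLen (π⁻¹ * γ)) = -((r + 1 : ℕ) : ℤ) :=
          ⟨(ppLen V π + permLen (π⁻¹ * γ) - ppLen ⊤ γ - 1).toNat, by
            have := lt_of_le_of_ne hle (Ne.symm heq)
            omega⟩
        rw [hr]
        have h0 : Tendsto (fun n : ℕ => (n : ℂ) ^ (-((r + 1 : ℕ) : ℤ))) atTop (nhds 0) := by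
          have := (tendsto_inv_atTop_nhds_zero_nat (𝕜 := ℂ)).pow (r + 1)
          rw [zero_pow r.succ_ne_zero] at this
          simpa only [zpow_neg, zpow_natCast, ← inv_pow] using this
        simpa using h0.mul (hK kk V π h.1)
    · have h' : ¬ (permLePartition π V ∧ ppLe V π ⊤ γ) := fun h'' => h ⟨h''.1, h''.2.1⟩
      simp only [h, h', if_false]
      exact tendsto_const_nhds
  refine hlim.congr' ?_
  filter_upwards [eventually_ge_atTop kk] with n hn
  have hn0 : n ≠ 0 := by omega
  have hn0' : (n : ℂ) ≠ 0 := Nat.cast_ne_zero.2 hn0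
  rw [cumulant_ncTrace (E n) (hk n) (hX n) hp hγ hn hn0, Finset.mul_sum]
  refine Finset.sum_congr rfl fun V _ => ?_
  rw [Finset.mul_sum]
  refine Finset.sum_congr rfl fun π _ => ?_
  rw [mul_ite, mul_zero, kappaSeq, dif_pos hn, ← mul_assoc, ← mul_assoc, ← zpow_add₀ hn0',
    ← zpow_add₀ hn0']
  have hexp : ppLen ⊤ γ - (ppLen V π + permLen (π⁻¹ * γ)) + ppLen V π =
      2 * (l : ℤ) - 2 + ((numCycles (π⁻¹ * γ) : ℤ) - l) := by
    rw [hlen, permLen]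
    ring
  rw [hexp]

end HOF
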